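/- For each j with 1 ≤ j ≤ m, the set T_j is connected and nonempty (it contains the nonempty set Z_j). -/

import Mathlib

theorem IsPreirreducible.inter_isOpen {X : Type*} [TopologicalSpace X] {S U : Set X}
    (hS : IsPreirreducible S) (hU : IsOpen U) : IsPreirreducible (S ∩ U) := by
  rintro u v hu hv ⟨x, ⟨hxS, hxU⟩, hxu⟩ ⟨y, ⟨hyS, hyU⟩, hyv⟩
  obtain ⟨z, hzS, ⟨hzU, hzu⟩, -, hzv⟩ := hS (U ∩ u) (U ∩ v) (hU.inter hu) (hU.inter hv)
    ⟨x, hxS, hxU, hxu⟩ ⟨y, hyS, hyU, hyv⟩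
  exact ⟨z, ⟨hzS, hzU⟩, hzu, hzv⟩

theorem IsClosed.isClosed_connectedComponentIn {X : Type*} [TopologicalSpace X] {F : Set X}
    (hF : IsClosed F) (x : X) : IsClosed (connectedComponentIn F x) := by
  by_cases hx : x ∈ F
  · rw [connectedComponentIn_eq_image hx]
    exact hF.isClosedEmbedding_subtypeVal.isClosedMap _ isClosed_connectedComponent
  · rw [connectedComponentIn_eq_empty hx]
    exact isClosed_empty

/-- A connected set `A` together with the traces on an open set `U ⊇ A` of the members of a family
of irreducible sets that covers `A` and whose members all meet `A` is preconnected. -/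
theorem IsPreconnected.biUnion_inter_isOpen {X ι : Type*} [TopologicalSpace X] {A U : Set X}
    (hA : IsPreconnected A) (hA' : A.Nonempty) (hU : IsOpen U) (hAU : A ⊆ U) {I : Set ι}
    {C : ι → Set X} (hC : ∀ i ∈ I, IsPreirreducible (C i))
    (hCA : ∀ i ∈ I, (C i ∩ A).Nonempty) (hAC : A ⊆ ⋃ i ∈ I, C i) :
    IsPreconnected ((⋃ i ∈ I, C i) ∩ U) := by
  obtain ⟨x, hx⟩ := hA'
  refine isPreconnected_of_forall x fun y ⟨hy, hyU⟩ => ?_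
  obtain ⟨i, hi, hyi⟩ := Set.mem_iUnion₂.1 hy
  obtain ⟨w, hwC, hwA⟩ := hCA i hi
  exact ⟨A ∪ C i ∩ U, Set.union_subset (Set.subset_inter hAC hAU)
    (Set.inter_subset_inter_left U (Set.subset_biUnion_of_mem hi)), Or.inl hx, Or.inr ⟨hyi, hyU⟩,
    hA.union w hwA ⟨hwC, hAU hwA⟩ ((hC i hi).inter_isOpen hU).isPreconnected⟩

/-
Setting (Section 2.3 of the paper, topological abstraction):
`X` is a nonempty connected Noetherian topological space with irreducible
components `C 0, …, C (n-1)`.  `Z ⊆ X` is a closed subset containing all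
pairwise intersections of irreducible components and containing no irreducible
component.  `W 0, …, W (m-1)` are the connected components of `Z`, and
`T j := (⋃_{i : C i ∩ W j ≠ ∅} C i) \ (⋃_{t ≠ j} W t)`.
-/
/-- Lemma 2.7(1): each `T j` is connected and nonempty (it contains the nonempty `W j`). -/
theorem proetale_stmt7
    {X : Type*} [TopologicalSpace X] [Nonempty X]
    [TopologicalSpace.NoetherianSpace X] [ConnectedSpace X]
    {n m : ℕ}
    (C : Fin n → Set X) (hCinj : Function.Injective C)
    (hCrange : Set.range C = irreducibleComponents X)
    (Z : Set X) (hZclosed : IsClosed Z)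
    (hZsing : ∀ i s : Fin n, i ≠ s → C i ∩ C s ⊆ Z)
    (hZnotcomp : ∀ i, ¬ C i ⊆ Z)
    (W : Fin m → Set X)
    (hWinj : Function.Injective W)
    (hWcc : ∀ j, ∃ x ∈ Z, W j = connectedComponentIn Z x)
    (hWall : (⋃ j, W j) = Z)
    (T : Fin m → Set X)
    (hT : ∀ j, T j = (⋃ i ∈ {i : Fin n | (C i ∩ W j).Nonempty}, C i) \
      (⋃ t ∈ {t : Fin m | t ≠ j}, W t))
    : ∀ j : Fin m, IsConnected (T j) ∧ W j ⊆ T j ∧ (W j).Nonempty := by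
  intro j
  have hclosed : ∀ t, IsClosed (W t) := fun t => by
    obtain ⟨x, -, hx⟩ := hWcc t
    exact hx ▸ hZclosed.isClosed_connectedComponentIn x
  have hdisj : ∀ t, t ≠ j → ∀ y ∈ W j, y ∉ W t := fun t htj y hyj hyt => by
    obtain ⟨a, -, ha⟩ := hWcc t
    obtain ⟨b, -, hb⟩ := hWcc j
    apply htj
    apply hWinj
    rw [ha] at hyt ⊢
    rw [hb] at hyj ⊢
    rw [connectedComponentIn_eq hyt, connectedComponentIn_eq hyj]
  have hne : (W j).Nonempty := by
    obtain ⟨x, hxZ, hx⟩ := hWcc j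
    exact ⟨x, hx ▸ mem_connectedComponentIn hxZ⟩
  have hconn : IsPreconnected (W j) := by
    obtain ⟨x, -, hx⟩ := hWcc j
    exact hx ▸ isPreconnected_connectedComponentIn
  have hCmem : ∀ i, C i ∈ irreducibleComponents X := fun i => hCrange ▸ Set.mem_range_self i
  have hcover : W j ⊆ ⋃ i ∈ {i : Fin n | (C i ∩ W j).Nonempty}, C i := fun x hx => by
    obtain ⟨i, hi⟩ : irreducibleComponent x ∈ Set.range C :=
      hCrange ▸ irreducibleComponent_mem_irreducibleComponents x
    have hxi : x ∈ C i := hi ▸ mem_irreducibleComponent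
    exact Set.mem_iUnion₂.2 ⟨i, ⟨x, hxi, hx⟩, hxi⟩
  have hopen : IsOpen (⋃ t ∈ {t : Fin m | t ≠ j}, W t)ᶜ :=
    (Set.toFinite _).isClosed_biUnion (fun t _ => hclosed t) |>.isOpen_compl
  have hsub : W j ⊆ (⋃ t ∈ {t : Fin m | t ≠ j}, W t)ᶜ := fun y hy hy' => by
    obtain ⟨t, htj, hyt⟩ := Set.mem_iUnion₂.1 hy'
    exact hdisj t htj y hy hyt
  have hWT : W j ⊆ T j := hT j ▸ Set.subset_inter hcover hsub
  refine ⟨⟨hne.mono hWT, ?_⟩, hWT, hne⟩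
  rw [hT j, Set.sdiff_eq]
  exact hconn.biUnion_inter_isOpen hne hopen hsub (fun i _ => (hCmem i).1.isPreirreducible)
    (fun i hi => hi) hcover
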